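/- Let P(λ) = A_m λ^m + ⋯ + A_1 λ + A_0 be an n×n complex matrix polynomial with det A_m ≠ 0, let λ_1, …, λ_{nm} be the roots of det P(λ) with multiplicity, and let w_0, …, w_m be nonnegative reals with w_0 > 0, w(t) = Σ w_j t^j. Suppose λ_i is a simple root, P'(λ_i) is invertible, x_i, y_i ∈ ℂ^n are unit right and left eigenvectors at λ_i, and P'(λ_i)* y_i is not a scalar multiple of x_i. Then there exist matrices Δ_0, …, Δ_m with ‖Δ_j‖ ≤ ε* w_j for all j, where ε* = ‖P'(λ_i)‖ · ‖P'(λ_i)^{−1}‖ · ‖P(λ_i)‖ · |det A_m| · ∏_{j≠i}|λ_j − λ_i| / ( w(|λ_i|) · ‖adj(P(λ_i))‖ · ( ‖P'(λ_i)* y_i‖² − |y_i* P'(λ_i) x_i|² )^{1/2} ), such that λ_i is a multiple eigenvalue of Q(λ) = Σ_{j=0}^m (A_j + Δ_j) λ^j, i.e. λ_i is a root of det Q(λ) of multiplicity at least 2; in particular dist(P,λ_i) ≤ ε*. -/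

import Mathlib

noncomputable section

open Matrix

/-- Euclidean norm of a complex vector. -/
def enorm2 {n : ℕ} (x : Fin n → ℂ) : ℝ := Real.sqrt (∑ i, ‖x i‖ ^ 2)

/-- Spectral norm: the operator norm induced by the Euclidean vector norm. -/
def specNorm {n : ℕ} (A : Matrix (Fin n) (Fin n) ℂ) : ℝ :=
  sSup {r : ℝ | ∃ x : Fin n → ℂ, enorm2 x = 1 ∧ r = enorm2 (A.mulVec x)}

/-- Smallest singular value: the minimum of `‖A x‖` over Euclidean-unit vectors `x`. -/
def sminSV {n : ℕ} (A : Matrix (Fin n) (Fin n) ℂ) : ℝ :=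
  sInf {r : ℝ | ∃ x : Fin n → ℂ, enorm2 x = 1 ∧ r = enorm2 (A.mulVec x)}

/-- Evaluation of the matrix polynomial `P(z) = ∑ A_j z^j`. -/
def evalP {n m : ℕ} (A : Fin (m+1) → Matrix (Fin n) (Fin n) ℂ) (z : ℂ) :
    Matrix (Fin n) (Fin n) ℂ :=
  ∑ j : Fin (m+1), z ^ (j : ℕ) • A j

/-- Derivative `P'(z) = ∑_{j≥1} j A_j z^(j-1)`. -/
def derivP {n m : ℕ} (A : Fin (m+1) → Matrix (Fin n) (Fin n) ℂ) (z : ℂ) :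
    Matrix (Fin n) (Fin n) ℂ :=
  ∑ j : Fin (m+1), (((j : ℕ) : ℂ) * z ^ ((j : ℕ) - 1)) • A j

/-- The scalar polynomial `det P(λ)`. -/
def detPoly {n m : ℕ} (A : Fin (m+1) → Matrix (Fin n) (Fin n) ℂ) : Polynomial ℂ :=
  (Matrix.of fun i k => ∑ j : Fin (m+1), Polynomial.C (A j i k) * Polynomial.X ^ (j : ℕ)).det

/-- The weight polynomial `w(t) = ∑ w_j t^j`. -/
def wval {m : ℕ} (w : Fin (m+1) → ℝ) (t : ℝ) : ℝ := ∑ j : Fin (m+1), w j * t ^ (j : ℕ)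

theorem aux_jacobi {n : ℕ} (M : Matrix (Fin n) (Fin n) (Polynomial ℂ)) :
    Polynomial.derivative M.det =
      (M.adjugate * M.map (fun p => Polynomial.derivative p)).trace := by
  have h1 : ∀ b, (M.adjugate * M.map (fun p => Polynomial.derivative p)) b b =
      (M.updateCol b (fun k => Polynomial.derivative (M k b))).det := by
    intro b
    rw [← cramer_apply, cramer_eq_adjugate_mulVec]
    simp [Matrix.mul_apply, mulVec, dotProduct]
  rw [Matrix.trace]
  simp only [Matrix.diag_apply, h1]
  simp only [Matrix.det_apply, Polynomial.derivative_sum, Polynomial.derivative_smul]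
  rw [Finset.sum_comm]
  refine Finset.sum_congr rfl fun σ _ => ?_
  rw [← Finset.smul_sum, Polynomial.derivative_prod_finset]
  congr 1
  refine Finset.sum_congr rfl fun b _ => ?_
  rw [← Finset.prod_erase_mul _ _ (Finset.mem_univ b)]
  congr 1
  · refine Finset.prod_congr rfl fun k hk => ?_
    rw [updateCol_ne (Finset.ne_of_mem_erase hk)]
  · simp

theorem aux_ker {n : ℕ} (M : Matrix (Fin n) (Fin n) ℂ) (hadj : M.adjugate ≠ 0)
    (u : Fin n → ℂ) (hu : u ≠ 0) (hMu : M *ᵥ u = 0) (v : Fin n → ℂ) (hv : M *ᵥ v = 0) :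
    ∃ k : ℂ, v = k • u := by
  by_contra hcon
  push Not at hcon
  apply hadj
  ext i j
  rw [adjugate_apply, Matrix.zero_apply, ← exists_mulVec_eq_zero_iff]
  have key : ∃ z : Fin n → ℂ, z ≠ 0 ∧ M *ᵥ z = 0 ∧ z i = 0 := by
    by_cases hui : u i = 0
    · exact ⟨u, hu, hMu, hui⟩
    · refine ⟨v - (v i / u i) • u, ?_, ?_, ?_⟩
      · intro h
        exact hcon _ (sub_eq_zero.mp h)
      · rw [mulVec_sub, mulVec_smul, hMu, hv]; simp
      · simp [hui]
  obtain ⟨z, hz0, hz, hzi⟩ := key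
  refine ⟨z, hz0, ?_⟩
  ext k
  by_cases hk : k = j
  · subst hk
    simp [mulVec, hzi]
  · have := congrFun hz k
    simpa [mulVec, updateRow_ne hk] using this

theorem aux_adj {n : ℕ} (M : Matrix (Fin n) (Fin n) ℂ)
    (u y : Fin n → ℂ) (hu : u ≠ 0) (hy : y ≠ 0) (hMu : M *ᵥ u = 0) (hyM : y ᵥ* M = 0) :
    ∃ c : ℂ, M.adjugate = c • vecMulVec u y := by
  by_cases hadj : M.adjugate = 0
  · exact ⟨0, by simp [hadj]⟩
  have hdet : M.det = 0 := exists_mulVec_eq_zero_iff.mp ⟨u, hu, hMu⟩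
  have h1 := M.mul_adjugate
  have h2 := M.adjugate_mul
  rw [hdet, zero_smul] at h1 h2
  have hcol : ∀ j, ∃ k : ℂ, (fun i => M.adjugate i j) = k • u := by
    intro j
    apply aux_ker M hadj u hu hMu
    ext i
    exact congrFun (congrFun h1 i) j
  have hadjT : Mᵀ.adjugate ≠ 0 := by
    rw [← adjugate_transpose]
    intro h
    exact hadj (transpose_eq_zero.mp h)
  have hrow : ∀ i, ∃ k : ℂ, (fun j => M.adjugate i j) = k • y := by
    intro i
    apply aux_ker Mᵀ hadjT y hy (by rw [mulVec_transpose, hyM])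
    rw [mulVec_transpose]
    ext j
    exact congrFun (congrFun h2 i) j
  choose f hf using hcol
  choose g hg using hrow
  obtain ⟨a, ha⟩ := Function.ne_iff.mp hu
  refine ⟨g a / u a, ?_⟩
  ext i j
  have e1 := congrFun (hf j) i
  have e2 := congrFun (hf j) a
  have e3 := congrFun (hg a) j
  simp only [Pi.smul_apply, smul_eq_mul, Pi.zero_apply] at e1 e2 e3 ha
  simp only [Matrix.smul_apply, vecMulVec_apply, smul_eq_mul]
  rw [e1]
  field_simp
  linear_combination u i * (e3 - e2)

/-- polynomial matrix -/
def polyMat {n m : ℕ} (A : Fin (m+1) → Matrix (Fin n) (Fin n) ℂ) :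
    Matrix (Fin n) (Fin n) (Polynomial ℂ) :=
  Matrix.of fun i k => ∑ j : Fin (m+1), Polynomial.C (A j i k) * Polynomial.X ^ (j : ℕ)

theorem aux_evalMap {n m : ℕ} (A : Fin (m+1) → Matrix (Fin n) (Fin n) ℂ) (z : ℂ) :
    (Polynomial.evalRingHom z).mapMatrix (polyMat A) = evalP A z := by
  ext i k
  simp [polyMat, evalP, Polynomial.eval_finsetSum, Matrix.sum_apply]
  exact Finset.sum_congr rfl fun j _ => mul_comm _ _

theorem aux_derivMap {n m : ℕ} (A : Fin (m+1) → Matrix (Fin n) (Fin n) ℂ) (z : ℂ) :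
    (Polynomial.evalRingHom z).mapMatrix
      ((polyMat A).map (fun p => Polynomial.derivative p)) = derivP A z := by
  ext i k
  simp [polyMat, derivP, Polynomial.eval_finsetSum, Matrix.sum_apply,
    Polynomial.derivative_X_pow]
  exact Finset.sum_congr rfl fun j _ => mul_comm _ _

theorem aux_eval_det {n m : ℕ} (A : Fin (m+1) → Matrix (Fin n) (Fin n) ℂ) (z : ℂ) :
    (detPoly A).eval z = (evalP A z).det := by
  rw [← aux_evalMap, ← RingHom.map_det]; rfl

theorem aux_eval_deriv {n m : ℕ} (A : Fin (m+1) → Matrix (Fin n) (Fin n) ℂ) (z : ℂ) :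
    (Polynomial.derivative (detPoly A)).eval z =
      ((evalP A z).adjugate * derivP A z).trace := by
  rw [← aux_evalMap, ← aux_derivMap, ← RingHom.map_adjugate, ← map_mul]
  rw [show detPoly A = (polyMat A).det from rfl, aux_jacobi]
  exact (AddMonoidHom.map_trace (Polynomial.evalRingHom z) _)

theorem aux_trace {n : ℕ} (c : ℂ) (u y : Fin n → ℂ) (D : Matrix (Fin n) (Fin n) ℂ) :
    ((c • vecMulVec u y) * D).trace = c * (y ⬝ᵥ D *ᵥ u) := by
  rw [smul_mul, trace_smul, vecMulVec_mul, trace_vecMulVec, dotProduct_mulVec, dotProduct_comm,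
    smul_eq_mul]

theorem aux_detPoly_ne {n m : ℕ} (B : Fin (m+1) → Matrix (Fin n) (Fin n) ℂ)
    (h : (B (Fin.last m)).det ≠ 0) : detPoly B ≠ 0 := by
  intro h0
  apply h
  have hz : ∀ z, (evalP B z).det = 0 := by
    intro z; rw [← aux_eval_det, h0, Polynomial.eval_zero]
  let f : ℂ → ℂ := fun t => (∑ j : Fin (m+1), t ^ (m - (j : ℕ)) • B j).det
  have hf : Continuous f := by
    apply Continuous.matrix_det
    fun_prop
  have hne : ∀ t : ℂ, t ≠ 0 → f t = 0 := by
    intro t ht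
    have : (∑ j : Fin (m+1), t ^ (m - (j : ℕ)) • B j) = t ^ m • evalP B t⁻¹ := by
      rw [evalP, Finset.smul_sum]
      refine Finset.sum_congr rfl fun j _ => ?_
      rw [smul_smul, pow_sub₀ _ ht (Nat.lt_succ_iff.mp j.2), inv_pow]
    simp only [f, this, det_smul, hz, mul_zero]
  have h1 : f 0 = 0 := by
    have hc : f = fun _ => 0 := by
      refine Continuous.ext_on (dense_compl_singleton (0:ℂ)) hf continuous_const ?_
      intro t ht
      exact hne t ht
    rw [hc]
  have h2 : f 0 = (B (Fin.last m)).det := by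
    simp only [f]
    rw [Finset.sum_eq_single (Fin.last m)]
    · simp
    · intro j _ hj
      have : (j : ℕ) < m := by
        have := Fin.val_lt_last hj
        simpa using this
      rw [zero_pow (by omega), zero_smul]
    · simp
  rw [← h2, h1]

theorem aux_mult {n m : ℕ} (B : Fin (m+1) → Matrix (Fin n) (Fin n) ℂ) (z : ℂ)
    (h : (B (Fin.last m)).det ≠ 0) (u y : Fin n → ℂ) (hu : u ≠ 0) (hy : y ≠ 0)
    (hMu : evalP B z *ᵥ u = 0) (hyM : y ᵥ* evalP B z = 0)
    (hD : y ⬝ᵥ derivP B z *ᵥ u = 0) :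
    2 ≤ Polynomial.rootMultiplicity z (detPoly B) := by
  have := (Polynomial.one_lt_rootMultiplicity_iff_isRoot (t := z) (aux_detPoly_ne B h)).mpr
  apply this
  constructor
  · rw [Polynomial.IsRoot, aux_eval_det]
    exact exists_mulVec_eq_zero_iff.mp ⟨u, hu, hMu⟩
  · obtain ⟨c, hc⟩ := aux_adj _ u y hu hy hMu hyM
    rw [Polynomial.IsRoot, aux_eval_deriv, hc, aux_trace, hD, mul_zero]

theorem aux_enorm {n : ℕ} (x : Fin n → ℂ) : enorm2 x = ‖WithLp.toLp 2 x‖ := by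
  rw [EuclideanSpace.norm_eq]; rfl

theorem aux_enorm_nonneg {n : ℕ} (x : Fin n → ℂ) : 0 ≤ enorm2 x := Real.sqrt_nonneg _

theorem aux_enorm_smul {n : ℕ} (c : ℂ) (x : Fin n → ℂ) :
    enorm2 (c • x) = ‖c‖ * enorm2 x := by
  rw [aux_enorm, aux_enorm, WithLp.toLp_smul, norm_smul]

theorem aux_enorm_eq_zero {n : ℕ} (x : Fin n → ℂ) : enorm2 x = 0 ↔ x = 0 := by
  rw [aux_enorm, norm_eq_zero]
  exact WithLp.toLp_eq_zero 2

theorem aux_self_dot {n : ℕ} (x : Fin n → ℂ) :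
    star x ⬝ᵥ x = ((enorm2 x ^ 2 : ℝ) : ℂ) := by
  rw [enorm2, Real.sq_sqrt (Finset.sum_nonneg fun _ _ => sq_nonneg _)]
  simp [dotProduct, Complex.conj_mul']

theorem aux_cs {n : ℕ} (x y : Fin n → ℂ) : ‖star x ⬝ᵥ y‖ ≤ enorm2 x * enorm2 y := by
  have h := norm_inner_le_norm (𝕜 := ℂ) (WithLp.toLp 2 x) (WithLp.toLp 2 y)
  rw [aux_enorm, aux_enorm]
  rwa [EuclideanSpace.inner_eq_star_dotProduct, dotProduct_comm] at h

theorem aux_bdd {n : ℕ} (A : Matrix (Fin n) (Fin n) ℂ) :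
    ∃ C, ∀ v, enorm2 (A *ᵥ v) ≤ C * enorm2 v := by
  refine ⟨‖Matrix.toEuclideanCLM (𝕜 := ℂ) A‖, fun v => ?_⟩
  have := (Matrix.toEuclideanCLM (𝕜 := ℂ) A).le_opNorm (WithLp.toLp 2 v)
  rw [aux_enorm, aux_enorm]
  exact this

theorem aux_spec_nonneg {n : ℕ} (A : Matrix (Fin n) (Fin n) ℂ) : 0 ≤ specNorm A := by
  apply Real.sSup_nonneg
  rintro r ⟨x, _, rfl⟩
  exact aux_enorm_nonneg _

theorem aux_le_spec {n : ℕ} (A : Matrix (Fin n) (Fin n) ℂ) (v : Fin n → ℂ) :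
    enorm2 (A *ᵥ v) ≤ specNorm A * enorm2 v := by
  by_cases hv : v = 0
  · subst hv
    have h0 : enorm2 (0 : Fin n → ℂ) = 0 := (aux_enorm_eq_zero _).mpr rfl
    simp [h0]
  have hpos : 0 < enorm2 v :=
    lt_of_le_of_ne (aux_enorm_nonneg v) (fun h => hv ((aux_enorm_eq_zero v).mp h.symm))
  obtain ⟨C, hC⟩ := aux_bdd A
  have h1 : enorm2 (((enorm2 v)⁻¹ : ℂ) • v) = 1 := by
    rw [aux_enorm_smul, norm_inv, Complex.norm_real, Real.norm_of_nonneg hpos.le,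
      inv_mul_cancel₀ hpos.ne']
  have h2 : enorm2 (A *ᵥ (((enorm2 v)⁻¹ : ℂ) • v)) ≤ specNorm A := by
    apply le_csSup
    · refine ⟨C, ?_⟩
      rintro r ⟨x, hx, rfl⟩
      have := hC x
      rwa [hx, mul_one] at this
    · exact ⟨_, h1, rfl⟩
  rw [mulVec_smul, aux_enorm_smul, norm_inv, Complex.norm_real, Real.norm_of_nonneg hpos.le] at h2
  rwa [inv_mul_le_iff₀ hpos, mul_comm] at h2

theorem aux_spec_le {n : ℕ} (A : Matrix (Fin n) (Fin n) ℂ) (C : ℝ) (hC : 0 ≤ C)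
    (h : ∀ v, enorm2 (A *ᵥ v) ≤ C * enorm2 v) : specNorm A ≤ C := by
  apply Real.sSup_le _ hC
  rintro r ⟨x, hx, rfl⟩
  have := h x
  rwa [hx, mul_one] at this

theorem aux_spec_pos {n : ℕ} (A : Matrix (Fin n) (Fin n) ℂ) (hA : A ≠ 0) : 0 < specNorm A := by
  refine lt_of_le_of_ne (aux_spec_nonneg A) fun h0 => hA ?_
  apply Matrix.ext_of_mulVec_single
  intro i
  have := aux_le_spec A (Pi.single i 1)
  rw [← h0, zero_mul] at this
  rw [(aux_enorm_eq_zero _).mp (le_antisymm this (aux_enorm_nonneg _)), zero_mulVec]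

theorem aux_spec_vecMulVec {n : ℕ} (c : ℂ) (p q : Fin n → ℂ) :
    specNorm (c • vecMulVec p (star q)) ≤ ‖c‖ * enorm2 p * enorm2 q := by
  apply aux_spec_le
  · have := aux_enorm_nonneg p
    have := aux_enorm_nonneg q
    positivity
  intro v
  have h : (c • vecMulVec p (star q)) *ᵥ v = (c * (star q ⬝ᵥ v)) • p := by
    ext k
    simp [smul_mulVec, vecMulVec_mulVec]
    ring
  rw [h, aux_enorm_smul, norm_mul]
  have := mul_le_mul_of_nonneg_left (aux_cs q v)
    (mul_nonneg (norm_nonneg c) (aux_enorm_nonneg p))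
  nlinarith [this]

theorem aux_cond {n : ℕ} (D : Matrix (Fin n) (Fin n) ℂ) (hD : IsUnit D) (x : Fin n → ℂ)
    (hx : enorm2 x = 1) : 1 ≤ specNorm D * specNorm D⁻¹ := by
  have h : D *ᵥ (D⁻¹ *ᵥ x) = x := by
    rw [mulVec_mulVec, Matrix.mul_nonsing_inv _ ((Matrix.isUnit_iff_isUnit_det _).mp hD),
      one_mulVec]
  have h1 := aux_le_spec D (D⁻¹ *ᵥ x)
  have h2 := mul_le_mul_of_nonneg_left (aux_le_spec D⁻¹ x) (aux_spec_nonneg D)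
  rw [h, hx] at h1
  rw [hx, mul_one] at h2
  exact h1.trans h2

theorem aux_coeff {m : ℕ} (hm : 0 < m) (w : Fin (m+1) → ℝ) (hw : ∀ j, 0 ≤ w j) (hw0 : 0 < w 0)
    (z a κ : ℂ) (ha : a ≠ 0) (ρ : ℝ) (hρ : 1 < ρ) :
    ∃ c : Fin (m+1) → ℂ, (∀ j, ‖c j‖ ≤ ρ * (w j / wval w ‖z‖)) ∧
      ∑ j : Fin (m+1), z ^ (j : ℕ) * c j = 1 ∧ a + c (Fin.last m) * κ ≠ 0 := by
  set W := wval w ‖z‖ with hWdef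
  have hW : 0 < W := by
    have : w 0 * ‖z‖ ^ ((0 : Fin (m+1)) : ℕ) ≤ W :=
      Finset.single_le_sum (f := fun j : Fin (m+1) => w j * ‖z‖ ^ (j : ℕ))
        (fun j _ => mul_nonneg (hw j) (by positivity)) (Finset.mem_univ 0)
    simp at this
    linarith
  have hs : ∃ s : ℂ, ‖s‖ = 1 ∧ z * s = ‖z‖ := by
    by_cases hz : z = 0
    · exact ⟨1, by simp, by simp [hz]⟩
    · have hz' : (‖z‖ : ℂ) ≠ 0 := by simpa using hz
      refine ⟨‖z‖ / z, ?_, by field_simp⟩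
      rw [norm_div, Complex.norm_real, norm_norm, div_self (by simpa using hz)]
  obtain ⟨s, hs1, hzs⟩ := hs
  let b : Fin (m+1) → ℂ := fun j => ((w j / W : ℝ) : ℂ) * s ^ (j : ℕ)
  have hbn : ∀ j, ‖b j‖ = w j / W := by
    intro j
    simp only [b]
    rw [norm_mul, norm_pow, hs1, one_pow, mul_one, Complex.norm_real,
      Real.norm_of_nonneg (div_nonneg (hw j) hW.le)]
  have hbs : ∑ j : Fin (m+1), z ^ (j : ℕ) * b j = 1 := by
    have : ∀ j : Fin (m+1), z ^ (j : ℕ) * b j = ((w j * ‖z‖ ^ (j : ℕ) / W : ℝ) : ℂ) := by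
      intro j
      simp only [b]
      push_cast
      rw [← hzs, mul_pow]; ring
    simp only [this]
    rw [← Complex.ofReal_sum, ← Finset.sum_div]
    change (((W / W : ℝ)) : ℂ) = 1
    rw [div_self hW.ne', Complex.ofReal_one]
  by_cases hgood : a + b (Fin.last m) * κ = 0
  swap
  · refine ⟨b, fun j => ?_, hbs, hgood⟩
    rw [hbn]
    have := div_nonneg (hw j) hW.le
    nlinarith
  set T := ‖b (Fin.last m)‖ * ‖z‖ ^ m with hT
  have hT0 : 0 ≤ T := by positivity
  obtain ⟨η, hη0, hη1, hηT⟩ : ∃ η : ℝ, 0 < η ∧ η ≤ 1 ∧ η * T ≤ (ρ - 1) * (w 0 / W) := by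
    have hR : 0 < (ρ - 1) * (w 0 / W) := mul_pos (by linarith) (div_pos hw0 hW)
    set R := (ρ - 1) * (w 0 / W)
    refine ⟨min 1 (R / (T + 1)), by positivity, min_le_left _ _, ?_⟩
    have h1 : min 1 (R / (T + 1)) ≤ R / (T+1) := min_le_right _ _
    calc min 1 (R / (T + 1)) * T ≤ R / (T+1) * T := by gcongr
      _ ≤ R / (T+1) * (T+1) := by gcongr; linarith
      _ = R := by field_simp
  have hne : (0 : Fin (m+1)) ≠ Fin.last m := by
    intro h
    have := congrArg Fin.val h
    simp at this
    omega
  let e : Fin (m+1) → ℂ := Pi.single 0 ((η : ℂ) * (b (Fin.last m) * z ^ m)) -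
    Pi.single (Fin.last m) ((η : ℂ) * b (Fin.last m))
  have e0 : e 0 = (η : ℂ) * (b (Fin.last m) * z ^ m) := by
    simp [e, hne]
  have el : e (Fin.last m) = - ((η : ℂ) * b (Fin.last m)) := by
    simp [e, hne.symm]
  have eo : ∀ j, j ≠ 0 → j ≠ Fin.last m → e j = 0 := by
    intro j h0 hl
    simp [e, h0, hl]
  refine ⟨b + e, fun j => ?_, ?_, ?_⟩
  · by_cases h0 : j = 0
    · subst h0
      rw [Pi.add_apply, e0]
      refine (norm_add_le _ _).trans ?_
      rw [hbn, norm_mul, norm_mul, norm_pow, Complex.norm_real, Real.norm_of_nonneg hη0.le]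
      linarith
    by_cases hl : j = Fin.last m
    · subst hl
      rw [Pi.add_apply, el]
      have : b (Fin.last m) + -((η : ℂ) * b (Fin.last m)) =
          ((1 - η : ℝ) : ℂ) * b (Fin.last m) := by
        push_cast; ring
      rw [this, norm_mul, hbn, Complex.norm_real, Real.norm_of_nonneg (by linarith)]
      exact mul_le_mul_of_nonneg_right (by linarith) (div_nonneg (hw _) hW.le)
    · rw [Pi.add_apply, eo j h0 hl, add_zero, hbn]
      have := div_nonneg (hw j) hW.le
      nlinarith
  · simp only [Pi.add_apply, mul_add, Finset.sum_add_distrib, hbs]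
    have : ∑ j : Fin (m+1), z ^ (j : ℕ) * e j = 0 := by
      simp only [e, Pi.sub_apply, mul_sub, Finset.sum_sub_distrib, Pi.single_apply, mul_ite,
        mul_zero, Finset.sum_ite_eq', Finset.mem_univ, if_true]
      simp
      ring
    rw [this, add_zero]
  · rw [Pi.add_apply, el]
    intro h
    have h3 : (η : ℂ) * (b (Fin.last m) * κ) = 0 := by linear_combination hgood - h
    have hη' : (η : ℂ) ≠ 0 := by exact_mod_cast hη0.ne'
    have h4 := (mul_eq_zero.mp h3).resolve_left hη'
    rw [h4, add_zero] at hgood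
    exact ha hgood

theorem aux_det_affine {n : ℕ} (M : Matrix (Fin n) (Fin n) ℂ) (hM : M.det ≠ 0)
    (p q : Fin n → ℂ) :
    ∃ κ : ℂ, ∀ t : ℂ, (M + t • vecMulVec p q).det = M.det + t * κ := by
  refine ⟨M.det * (q ⬝ᵥ M⁻¹ *ᵥ p), fun t => ?_⟩
  have h := det_add_replicateCol_mul_replicateRow (ι := Unit) (A := M)
    (isUnit_iff_ne_zero.mpr hM) (t • p) q
  have e : replicateCol Unit (t • p) * replicateRow Unit q = t • vecMulVec p q := by
    ext i j
    simp [Matrix.mul_apply, vecMulVec_apply]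
    try ring
  rw [e] at h
  rw [h, det_unique (n := Unit), Matrix.mul_assoc]
  have e2 : (replicateRow Unit q * (M⁻¹ * replicateCol Unit (t • p))) default default =
      t * (q ⬝ᵥ M⁻¹ *ᵥ p) := by
    simp [Matrix.mul_apply, dotProduct, mulVec, Finset.mul_sum]
    refine Finset.sum_congr rfl fun a _ => Finset.sum_congr rfl fun b _ => ?_
    ring
  rw [Matrix.add_apply, e2, one_apply_eq]
  ring

theorem aux_evalP_add {n m : ℕ} (A : Fin (m+1) → Matrix (Fin n) (Fin n) ℂ) (c : Fin (m+1) → ℂ)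
    (E : Matrix (Fin n) (Fin n) ℂ) (z : ℂ) :
    evalP (fun j => A j + c j • E) z = evalP A z + (∑ j : Fin (m+1), z ^ (j : ℕ) * c j) • E := by
  simp only [evalP, smul_add, Finset.sum_add_distrib, smul_smul, Finset.sum_smul]

theorem aux_derivP_add {n m : ℕ} (A : Fin (m+1) → Matrix (Fin n) (Fin n) ℂ) (c : Fin (m+1) → ℂ)
    (E : Matrix (Fin n) (Fin n) ℂ) (z : ℂ) :
    ∃ φ : ℂ, derivP (fun j => A j + c j • E) z = derivP A z + φ • E := by
  refine ⟨∑ j : Fin (m+1), (((j : ℕ) : ℂ) * z ^ ((j : ℕ) - 1)) * c j, ?_⟩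
  simp only [derivP, smul_add, Finset.sum_add_distrib, smul_smul, Finset.sum_smul]

theorem aux_fact_deriv {k : ℕ} (a : ℂ) (lam : Fin k → ℂ) (i : Fin k) :
    (Polynomial.derivative (Polynomial.C a *
        ∏ j : Fin k, (Polynomial.X - Polynomial.C (lam j)))).eval (lam i) =
      a * ∏ j ∈ Finset.univ.erase i, (lam i - lam j) := by
  rw [← Finset.mul_prod_erase _ _ (Finset.mem_univ i)]
  simp [Polynomial.derivative_mul, Polynomial.eval_prod]

/-- Corollary 5.5, second part: eigenvector-free upper bound for the
distance from `P` to the matrix polynomials having `λ_i` as a multiple eigenvalue. -/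
theorem stmt6 {n m : ℕ}
    (A : Fin (m+1) → Matrix (Fin n) (Fin n) ℂ)
    (hAm : (A (Fin.last m)).det ≠ 0)
    (w : Fin (m+1) → ℝ) (hw : ∀ j, 0 ≤ w j) (hw0 : 0 < w 0)
    (lam : Fin (n * m) → ℂ)
    (hfact : detPoly A =
      Polynomial.C ((A (Fin.last m)).det) *
        ∏ j : Fin (n * m), (Polynomial.X - Polynomial.C (lam j)))
    (i : Fin (n * m)) (hsimple : ∀ j, j ≠ i → lam j ≠ lam i)
    (hP' : IsUnit (derivP A (lam i)))
    (x y : Fin n → ℂ)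
    (hx1 : enorm2 x = 1) (hy1 : enorm2 y = 1)
    (hx : (evalP A (lam i)).mulVec x = 0)
    (hy : Matrix.vecMul (star y) (evalP A (lam i)) = 0)
    (hns : ¬ ∃ c : ℂ, (derivP A (lam i))ᴴ.mulVec y = c • x) :
    ∃ Δ : Fin (m+1) → Matrix (Fin n) (Fin n) ℂ,
      (∀ j, specNorm (Δ j) ≤
          (specNorm (derivP A (lam i)) * specNorm (derivP A (lam i))⁻¹ *
              specNorm (evalP A (lam i)) * ‖(A (Fin.last m)).det‖ *
              ∏ j ∈ Finset.univ.erase i, ‖lam j - lam i‖) /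
            (wval w ‖lam i‖ *
              specNorm (Matrix.adjugate (evalP A (lam i))) *
              Real.sqrt (enorm2 ((derivP A (lam i))ᴴ.mulVec y) ^ 2 -
                ‖star y ⬝ᵥ (derivP A (lam i)).mulVec x‖ ^ 2)) * w j) ∧
      2 ≤ Polynomial.rootMultiplicity (lam i) (detPoly (fun j => A j + Δ j)) := by
  set z := lam i with hz
  set P := evalP A z with hPdef
  set D := derivP A z with hDdef
  set d := Dᴴ *ᵥ y with hd
  set g := star y ⬝ᵥ D *ᵥ x with hg
  have hm : 0 < m := by
    rcases Nat.eq_zero_or_pos m with h | h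
    · subst h; exact absurd i.2 (by simp)
    · exact h
  have hx0 : x ≠ 0 := by
    intro h; rw [(aux_enorm_eq_zero x).mpr h] at hx1; norm_num at hx1
  have hy0 : y ≠ 0 := by
    intro h; rw [(aux_enorm_eq_zero y).mpr h] at hy1; norm_num at hy1
  have hsy0 : star y ≠ 0 := by simpa using hy0
  -- adjugate
  obtain ⟨c0, hc0⟩ := aux_adj P x (star y) hx0 hsy0 hx hy
  have hder : (A (Fin.last m)).det * ∏ j ∈ Finset.univ.erase i, (z - lam j) = c0 * g := by
    rw [← aux_trace, ← hc0, hPdef, hDdef, ← aux_eval_deriv, hfact, hz, aux_fact_deriv]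
  have hnum : ‖(A (Fin.last m)).det‖ * ∏ j ∈ Finset.univ.erase i, ‖lam j - z‖ = ‖c0‖ * ‖g‖ := by
    rw [← norm_mul c0, ← hder, norm_mul, norm_prod]
    congr 1
    exact Finset.prod_congr rfl fun j _ => norm_sub_rev _ _
  have hK : c0 * g ≠ 0 := by
    rw [← hder]
    refine mul_ne_zero hAm (Finset.prod_ne_zero_iff.mpr fun j hj => ?_)
    exact sub_ne_zero.mpr (hsimple j (Finset.ne_of_mem_erase hj)).symm
  have hc00 : c0 ≠ 0 := left_ne_zero_of_mul hK
  have hg0 : g ≠ 0 := right_ne_zero_of_mul hK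
  have hadj : P.adjugate ≠ 0 := by
    intro h
    rw [h, ] at hc0
    have := aux_trace c0 x (star y) D
    rw [← hc0, Matrix.zero_mul, trace_zero] at this
    exact hK this.symm
  have hadj_pos := aux_spec_pos _ hadj
  have hadj_le : specNorm P.adjugate ≤ ‖c0‖ := by
    have := aux_spec_vecMulVec c0 x y
    rw [hx1, hy1, mul_one, mul_one, ← hc0] at this
    exact this
  have hP0 : P ≠ 0 := by
    intro h
    exact hns (aux_ker P hadj x hx0 hx d (by rw [h, zero_mulVec]))
  have hPpos := aux_spec_pos _ hP0
  -- inner products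
  have hdD : ∀ v, star d ⬝ᵥ v = star y ⬝ᵥ D *ᵥ v := by
    intro v
    rw [hd, star_mulVec, conjTranspose_conjTranspose, dotProduct_mulVec]
  have hdx : star d ⬝ᵥ x = g := hdD x
  have hxd : star x ⬝ᵥ d = star g := by
    rw [← hdx, star_dotProduct]
  have hxx := aux_self_dot x
  have hdd := aux_self_dot d
  rw [hx1] at hxx
  have hd0 : 0 < enorm2 d := by
    refine lt_of_le_of_ne (aux_enorm_nonneg d) fun h => hns ⟨0, ?_⟩
    rw [zero_smul]; exact (aux_enorm_eq_zero d).mp h.symm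
  set δ := enorm2 d with hδ
  have hgg : star g * g = ((‖g‖ ^ 2 : ℝ) : ℂ) := by
    simpa using Complex.conj_mul' g
  -- residual vector
  set r := d - star g • x with hr
  have hrr : enorm2 r ^ 2 = δ ^ 2 - ‖g‖ ^ 2 := by
    have : star r ⬝ᵥ r = ((δ ^ 2 - ‖g‖ ^ 2 : ℝ) : ℂ) := by
      rw [hr]
      simp only [star_sub, star_smul, sub_dotProduct, dotProduct_sub, smul_dotProduct,
        dotProduct_smul, star_star, smul_eq_mul, hdx, hxd, hxx, hdd]
      rw [Complex.ofReal_sub, ← hgg]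
      push_cast
      ring
    rw [aux_self_dot] at this
    exact_mod_cast this
  have hr0 : 0 < enorm2 r := by
    refine lt_of_le_of_ne (aux_enorm_nonneg r) fun h => hns ⟨star g, ?_⟩
    exact sub_eq_zero.mp ((aux_enorm_eq_zero r).mp h.symm)
  set S := enorm2 r with hS
  have hsqrt : Real.sqrt (δ ^ 2 - ‖g‖ ^ 2) = S := by
    rw [← hrr, Real.sqrt_sq hr0.le]
  rw [hsqrt]
  have hgpos : 0 < ‖g‖ := norm_pos_iff.mpr hg0
  have hSδ : S < δ := by
    apply lt_of_pow_lt_pow_left₀ 2 hd0.le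
    nlinarith
  -- new eigenvector
  set u := ((δ ^ 2 : ℝ) : ℂ) • x - g • d with hu
  have huu : enorm2 u ^ 2 = (δ * S) ^ 2 := by
    have : star u ⬝ᵥ u = ((δ ^ 2 * (δ ^ 2 - ‖g‖ ^ 2) : ℝ) : ℂ) := by
      rw [hu]
      simp only [star_sub, star_smul, sub_dotProduct, dotProduct_sub, smul_dotProduct,
        dotProduct_smul, smul_eq_mul, hdx, hxd, hxx, hdd]
      rw [Complex.ofReal_mul, Complex.ofReal_sub, ← hgg, show star ((δ ^ 2 : ℝ) : ℂ) = ((δ ^ 2 : ℝ) : ℂ) from Complex.conj_ofReal _]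
      push_cast
      ring
    rw [aux_self_dot] at this
    rw [mul_pow, hrr]
    exact_mod_cast this
  have hun : enorm2 u = δ * S := by
    rwa [sq_eq_sq₀ (aux_enorm_nonneg u) (by positivity)] at huu
  have hupos : 0 < enorm2 u := by rw [hun]; positivity
  have hu0 : u ≠ 0 := fun h => hupos.ne' ((aux_enorm_eq_zero u).mpr h)
  have hdu : star y ⬝ᵥ D *ᵥ u = 0 := by
    rw [← hdD, hu, dotProduct_sub, dotProduct_smul, dotProduct_smul, hdx, hdd]
    simp only [smul_eq_mul]
    ring
  have hPu : enorm2 (P *ᵥ u) ≤ ‖g‖ * (specNorm P * S) := by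
    have : P *ᵥ u = (-g) • (P *ᵥ r) := by
      rw [hu, hr, mulVec_sub, mulVec_sub, mulVec_smul, mulVec_smul, mulVec_smul, hx]
      simp
    rw [this, aux_enorm_smul, norm_neg]
    exact mul_le_mul_of_nonneg_left (aux_le_spec P r) (norm_nonneg g)
  set t : ℂ := -(((enorm2 u ^ 2 : ℝ) : ℂ)⁻¹) with ht
  set E := t • vecMulVec (P *ᵥ u) (star u) with hE
  have hE_norm : specNorm E ≤ ‖g‖ * specNorm P / δ := by
    refine (aux_spec_vecMulVec t (P *ᵥ u) u).trans ?_
    rw [ht, norm_neg, norm_inv, Complex.norm_real, Real.norm_of_nonneg (by positivity)]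
    calc (enorm2 u ^ 2)⁻¹ * enorm2 (P *ᵥ u) * enorm2 u
        ≤ (enorm2 u ^ 2)⁻¹ * (‖g‖ * (specNorm P * S)) * enorm2 u := by gcongr
      _ = ‖g‖ * specNorm P / δ := by
        rw [hun]; field_simp
  have hEu : E *ᵥ u = - (P *ᵥ u) := by
    have hne : ((enorm2 u ^ 2 : ℝ) : ℂ) ≠ 0 := by
      exact_mod_cast (pow_pos hupos 2).ne'
    ext k
    rw [hE, smul_mulVec, vecMulVec_mulVec, aux_self_dot, ht]
    simp only [Pi.smul_apply, Pi.neg_apply, MulOpposite.smul_eq_mul_unop, MulOpposite.unop_op, smul_eq_mul]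
    field_simp
  have hyE : star y ᵥ* E = 0 := by
    rw [hE, vecMul_smul, vecMul_vecMulVec, dotProduct_mulVec, hy]
    simp
  obtain ⟨κ, hκ⟩ := aux_det_affine _ hAm (t • (P *ᵥ u)) (star u)
  obtain ⟨c, hcn, hcs, hcd⟩ := aux_coeff hm w hw hw0 z _ κ hAm (δ / S)
    ((one_lt_div hr0).mpr hSδ)
  refine ⟨fun j => c j • E, fun j => ?_, ?_⟩
  · have hW : 0 < wval w ‖z‖ := by
      have : w 0 * ‖z‖ ^ ((0 : Fin (m+1)) : ℕ) ≤ wval w ‖z‖ :=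
        Finset.single_le_sum (f := fun j : Fin (m+1) => w j * ‖z‖ ^ (j : ℕ))
          (fun j _ => mul_nonneg (hw j) (by positivity)) (Finset.mem_univ 0)
      simp at this
      linarith
    have hcond := aux_cond D hP' x hx1
    have h1 : specNorm (c j • E) ≤ ‖c j‖ * specNorm E := by
      apply aux_spec_le _ _ (mul_nonneg (norm_nonneg _) (aux_spec_nonneg _))
      intro v
      rw [smul_mulVec, aux_enorm_smul, mul_assoc]
      exact mul_le_mul_of_nonneg_left (aux_le_spec E v) (norm_nonneg _)
    set W := wval w ‖z‖
    have hwj := hw j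
    have hnumr : specNorm D * specNorm D⁻¹ * specNorm P * ‖(A (Fin.last m)).det‖ *
        ∏ j ∈ Finset.univ.erase i, ‖lam j - z‖ =
        specNorm D * specNorm D⁻¹ * specNorm P * (‖c0‖ * ‖g‖) := by
      rw [mul_assoc, hnum]
    rw [hnumr]
    calc specNorm (c j • E) ≤ ‖c j‖ * specNorm E := h1
      _ ≤ (δ / S * (w j / W)) * (‖g‖ * specNorm P / δ) :=
        mul_le_mul (hcn j) hE_norm (aux_spec_nonneg _) (by positivity)
      _ = 1 * specNorm P * (specNorm P.adjugate * ‖g‖) / (W * specNorm P.adjugate * S) * w j := by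
        field_simp
      _ ≤ specNorm D * specNorm D⁻¹ * specNorm P * (‖c0‖ * ‖g‖) /
          (W * specNorm P.adjugate * S) * w j := by
        gcongr
  · have hev : evalP (fun j => A j + c j • E) z = P + E := by
      rw [aux_evalP_add, hcs, one_smul]
    obtain ⟨φ, hφ⟩ := aux_derivP_add A c E z
    apply aux_mult _ z _ u (star y) hu0 hsy0
    · rw [hev, add_mulVec, hEu, add_neg_cancel]
    · rw [hev, vecMul_add, hy, hyE, add_zero]
    · rw [hφ, add_mulVec, dotProduct_add, ← hDdef, hdu, smul_mulVec, dotProduct_smul,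
        dotProduct_mulVec, hyE]
      simp
    · have h := hκ (c (Fin.last m))
      have e : vecMulVec (t • (P *ᵥ u)) (star u) = E := by
        rw [hE]; ext a b; simp [vecMulVec_apply, mul_assoc]
      rw [e] at h
      rw [h]
      exact hcd
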